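/- Let {X_n} be a stationary and ergodic time series with values in a finite or countably infinite set 𝒳, and fix 0 < γ < 1 and 0 < β with 2β + γ < 1. Then for every k < n, P(Δ̂_k^n > n^{−β} and K(X̃⁰_{−∞}) = k) ≤ 2 n (n+2) e^{−2 n^{1−2β−γ}}. -/

import Mathlib

open MeasureTheory Filter Set
open scoped ENNReal Topology

noncomputable section

namespace MWPrediction

/-- The canonical two-sided path space for a process with values in `𝒳`. -/
abbrev Path (𝒳 : Type*) := ℤ → 𝒳

variable {𝒳 : Type*}

/-- The left shift `(T ω) i = ω (i+1)` on two-sided sequences. -/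
def shift (ω : Path 𝒳) : Path 𝒳 := fun i => ω (i + 1)

/-- The one-sided past `X⁰_{-∞}`, recorded as `past ω i = X_{-i}`. -/
def past (ω : Path 𝒳) : ℕ → 𝒳 := fun i => ω (-(i : ℤ))

/-- The string `s` of length `m` (read right-to-left: `s j` is the symbol at
position `t - j`) occurs in `ω` ending at time `t`. -/
def OccursAt (ω : Path 𝒳) (m : ℕ) (s : ℕ → 𝒳) (t : ℤ) : Prop :=
  ∀ j < m, ω (t - (j : ℤ)) = s j

/-- The auxiliary stopping times `ζ_n`:  `ζ_0 = 0` and `ζ_n` is obtained from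
`ζ_{n-1}` by waiting for the recurrence of the block of length `l n` ending
at `ζ_{n-1}`. -/
def zeta (l : ℕ → ℕ) (ω : Path 𝒳) : ℕ → ℤ
  | 0 => 0
  | n + 1 =>
    zeta l ω n +
      ((sInf {t : ℕ | 0 < t ∧ ∀ s < l (n + 1),
          ω (zeta l ω n - (s : ℤ) + (t : ℤ)) = ω (zeta l ω n - (s : ℤ))} : ℕ) : ℤ)

/-- `J n = min { j ≥ 1 : l (j+1) > n }`. -/
def Jfun (l : ℕ → ℕ) (n : ℕ) : ℕ := sInf {j : ℕ | 1 ≤ j ∧ n < l (j + 1)}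

/-- The auxiliary process `X̃`: `tildePast l ω i = X̃_{-i} = X_{ζ_{J(i)} - i}`. -/
def tildePast (l : ℕ → ℕ) (ω : Path 𝒳) : ℕ → 𝒳 :=
  fun i => ω (zeta l ω (Jfun l i) - (i : ℤ))

variable [MeasurableSpace 𝒳]

/-- `pstr μ m s = P(X_{-m+1}^0 = s)`, the probability that the string `s` of
length `m` (read right-to-left) occupies positions `-m+1, …, 0`.
(So `pstr μ (k+1)` is `p_k` of the paper.) -/
def pstr (μ : Measure (Path 𝒳)) (m : ℕ) (s : ℕ → 𝒳) : ℝ :=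
  (μ {ω | ∀ j < m, ω (-(j : ℤ)) = s j}).toReal

/-- `pcond μ m y s = P(X_1 = y | X_{-m+1}^0 = s)`, conditioning on `m` symbols.
(So `pcond μ m` is `p_{m-1}(·|·)` of the paper.) -/
def pcond (μ : Measure (Path 𝒳)) (m : ℕ) (y : 𝒳) (s : ℕ → 𝒳) : ℝ :=
  (μ {ω | ω 1 = y ∧ ∀ j < m, ω (-(j : ℤ)) = s j}).toReal / pstr μ m s

/-- Append `y` as the new rightmost symbol of the string `s`. -/
def withLast (y : 𝒳) (s : ℕ → 𝒳) : ℕ → 𝒳 := fun j => if j = 0 then y else s (j - 1)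

/-- The string which agrees with `b` on its rightmost `k` symbols and continues
to the left with `z`:  this is the string `(z, b_{-k+1}^0)` of the paper. -/
def prependOld (b : ℕ → 𝒳) (k : ℕ) (z : ℕ → 𝒳) : ℕ → 𝒳 :=
  fun j => if j < k then b j else z (j - k)

/-- `K` is a memory bound for the past `b`: for all `i ≥ 1`, `y` and `z ∈ 𝒳^i`,
if `p_{K+i}(z, b_{-K+1}^0, y) > 0` then
`p_{K-1}(y | b_{-K+1}^0) = p_{K+i-1}(y | z, b_{-K+1}^0)`. -/
def IsMemoryBound (μ : Measure (Path 𝒳)) (b : ℕ → 𝒳) (K : ℕ) : Prop :=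
  ∀ i : ℕ, 1 ≤ i → ∀ y : 𝒳, ∀ z : ℕ → 𝒳,
    0 < pstr μ (K + i + 1) (withLast y (prependOld b K z)) →
    pcond μ K y b = pcond μ (K + i) y (prependOld b K z)

/-- The (random) memory length `K(b)` of a one-sided path `b`: the smallest
memory bound, and `∞` if there is none. -/
def memLen (μ : Measure (Path 𝒳)) (b : ℕ → 𝒳) : ℕ∞ :=
  sInf {n : ℕ∞ | ∃ K : ℕ, n = (K : ℕ∞) ∧ IsMemoryBound μ b K}

/-- `Δ_k(b_{-k+1}^0)`. -/
def Delta (μ : Measure (Path 𝒳)) (k : ℕ) (b : ℕ → 𝒳) : ℝ :=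
  sSup {d : ℝ | ∃ i : ℕ, 1 ≤ i ∧ ∃ z : ℕ → 𝒳, ∃ x : 𝒳,
    0 < pstr μ (k + i + 1) (withLast x (prependOld b k z)) ∧
    d = |pcond μ k x b - pcond μ (k + i) x (prependOld b k z)|}

/-- `⌈n/2⌉`. -/
def half (n : ℕ) : ℕ := (n + 1) / 2

open Classical in
/-- The number of times `t ∈ [a, b]` at which the string `s` of length `m`
occurs in `ω` ending at `t`. -/
def cnt (ω : Path 𝒳) (m : ℕ) (s : ℕ → 𝒳) (a b : ℤ) : ℕ :=
  ((Finset.Icc a b).filter fun t => OccursAt ω m s t).card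

/-- Membership in `ℒ_{n,m}^{(1)}`: the string `s` of length `m+1` occurs in
`X_0^{⌈n/2⌉ - 1}`. -/
def inL1 (ω : Path 𝒳) (n m : ℕ) (s : ℕ → 𝒳) : Prop :=
  ∃ t : ℤ, (m : ℤ) ≤ t ∧ t ≤ (half n : ℤ) - 1 ∧ OccursAt ω (m + 1) s t

/-- Membership in `ℒ_{n,m}^{(2)}`: the string `s` of length `m+1` occurs more
than `n^{1-γ}` times in `X_{⌈n/2⌉}^n`. -/
def inL2 (γ : ℝ) (ω : Path 𝒳) (n m : ℕ) (s : ℕ → 𝒳) : Prop :=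
  (n : ℝ) ^ (1 - γ) < (cnt ω (m + 1) s ((half n : ℤ) + (m : ℤ)) (n : ℤ) : ℝ)

/-- Membership in `ℒ_m^n = ℒ_{n,m}^{(1)} ∩ ℒ_{n,m}^{(2)}`. -/
def inL (γ : ℝ) (ω : Path 𝒳) (n m : ℕ) (s : ℕ → 𝒳) : Prop :=
  inL1 ω n m s ∧ inL2 γ ω n m s

/-- The empirical conditional relative frequency of `x` following the string
`s` of length `m`, computed in the second half `X_{⌈n/2⌉}^n` of the data. -/
def empCond (ω : Path 𝒳) (n m : ℕ) (x : 𝒳) (s : ℕ → 𝒳) : ℝ :=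
  (cnt ω (m + 1) (withLast x s) ((half n : ℤ) + (m : ℤ)) (n : ℤ) : ℝ) /
    (cnt ω m s ((half n : ℤ) + (m : ℤ) - 1) ((n : ℤ) - 1) : ℝ)

/-- The empirical statistic `Δ̂_k^n(X̃_{-k+1}^0)`. -/
def hatDelta (γ : ℝ) (l : ℕ → ℕ) (ω : Path 𝒳) (n k : ℕ) : ℝ :=
  (if zeta l ω (Jfun l k) ≤ (half n : ℤ) - 1 then (1 : ℝ) else 0) *
    sSup {d : ℝ | ∃ i : ℕ, 1 ≤ i ∧ i ≤ n ∧ ∃ z : ℕ → 𝒳, ∃ x : 𝒳,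
      inL γ ω n (k + i) (withLast x (prependOld (tildePast l ω) k z)) ∧
      d = |empCond ω n k x (tildePast l ω) -
            empCond ω n (k + i) x (prependOld (tildePast l ω) k z)|}

/-- The order estimate `χ_n`: the smallest `0 ≤ k < n` with `Δ̂_k^n ≤ n^{-β}`
(and `χ_0 = 0`). -/
def chi (β γ : ℝ) (l : ℕ → ℕ) (ω : Path 𝒳) (n : ℕ) : ℕ :=
  sInf {k : ℕ | k < n ∧ hatDelta γ l ω n k ≤ (n : ℝ) ^ (-β)}

/-- The index `j` with `ζ_j ≤ v < ζ_{j+1}`. -/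
def jIndex (l : ℕ → ℕ) (ω : Path 𝒳) (v : ℤ) : ℕ := sInf {j : ℕ | v < zeta l ω (j + 1)}

/-- The stopping times `λ_n`:  `λ_0 = 0` and, if `ζ_j ≤ λ_{n-1} < ζ_{j+1}`,
`λ_n = min { t > λ_{n-1} : X_{t - χ_t + 1}^t = X_{ζ_j - χ_t + 1}^{ζ_j} }`. -/
def lambda (β γ : ℝ) (l : ℕ → ℕ) (ω : Path 𝒳) : ℕ → ℤ
  | 0 => 0
  | n + 1 =>
    lambda β γ l ω n + 1 +
      ((sInf {s : ℕ |
          ∀ r < chi β γ l ω (lambda β γ l ω n + 1 + (s : ℤ)).toNat,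
            ω (lambda β γ l ω n + 1 + (s : ℤ) - (r : ℤ)) =
              ω (zeta l ω (jIndex l ω (lambda β γ l ω n)) - (r : ℤ))} : ℕ) : ℤ)

/-- `κ_n = χ_{λ_n}`. -/
def kappa (β γ : ℝ) (l : ℕ → ℕ) (ω : Path 𝒳) (n : ℕ) : ℕ :=
  chi β γ l ω (lambda β γ l ω n).toNat

/-- The estimator `f_n = (1/n) ∑_{j=0}^{n-1} f(X_{λ_j + 1})`. -/
def fEst (β γ : ℝ) (l : ℕ → ℕ) (f : 𝒳 → ℝ) (ω : Path 𝒳) (n : ℕ) : ℝ :=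
  (1 / (n : ℝ)) * ∑ j ∈ Finset.range n, f (ω (lambda β γ l ω j + 1))

open Classical in
/-- The metric `d*` on one-sided sequences. -/
def dstar (x y : ℕ → 𝒳) : ℝ :=
  ∑' i : ℕ, (2 : ℝ)⁻¹ ^ (i + 1) * (if x i ≠ y i then 1 else 0)

/-- `F` restricted to `C` is continuous with respect to the metric `d*`. -/
def ContinuousOnDstar (F : (ℕ → 𝒳) → ℝ) (C : Set (ℕ → 𝒳)) : Prop :=
  ∀ x ∈ C, ∀ ε > 0, ∃ δ > 0, ∀ y ∈ C, dstar x y < δ → |F y - F x| < ε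

/-- The σ-algebra generated by the one-sided past `X^0_{-∞}`. -/
def pastSigma (𝒳 : Type*) [MeasurableSpace 𝒳] : MeasurableSpace (Path 𝒳) :=
  MeasurableSpace.comap past inferInstance

/-- `F` is a version of the conditional expectation `E(f(X_1) | X^0_{-∞})`. -/
def IsPredictor (μ : Measure (Path 𝒳)) (f : 𝒳 → ℝ) (F : (ℕ → 𝒳) → ℝ) : Prop :=
  (fun ω => F (past ω)) =ᵐ[μ] μ[fun ω => f (ω 1)|pastSigma 𝒳]

/-- `F` (a version of `E(f(X_1)|X^0_{-∞})`) is almost surely continuous: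
it is continuous w.r.t. `d*` on a set of paths of probability one. -/
def ASContinuousCondExp (μ : Measure (Path 𝒳)) (F : (ℕ → 𝒳) → ℝ) : Prop :=
  ∃ C : Set (ℕ → 𝒳), μ (past ⁻¹' C) = 1 ∧ ContinuousOnDstar F C

/-- The observation `(λ_j, X_0^{λ_j})`, encoding the data segment available at
time `λ_j` (values before time `0` are clamped to `X_0`). -/
def segObs (β γ : ℝ) (l : ℕ → ℕ) (j : ℕ) (ω : Path 𝒳) : ℤ × (ℕ → 𝒳) :=
  (lambda β γ l ω j, fun i => ω (max (lambda β γ l ω j - (i : ℤ)) 0))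

/-- The σ-algebra generated by `(λ_j, X_0^{λ_j})`. -/
def segSigma (β γ : ℝ) (l : ℕ → ℕ) (j : ℕ) : MeasurableSpace (Path 𝒳) :=
  MeasurableSpace.comap (segObs β γ l j) inferInstance

/-- The observation `(λ_j, X_{-∞}^{λ_j})`: the full past at time `λ_j`. -/
def fullPastObs (β γ : ℝ) (l : ℕ → ℕ) (j : ℕ) (ω : Path 𝒳) : ℤ × (ℕ → 𝒳) :=
  (lambda β γ l ω j, fun i => ω (lambda β γ l ω j - (i : ℤ)))

/-- The σ-algebra generated by `(λ_j, X_{-∞}^{λ_j})`. -/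
def fullPastSigma (β γ : ℝ) (l : ℕ → ℕ) (j : ℕ) : MeasurableSpace (Path 𝒳) :=
  MeasurableSpace.comap (fullPastObs β γ l j) inferInstance

/-- The `n`-th term `-(1/(n+1)) ∑ p log₂ p` of the entropy rate. -/
def entropyTerm (μ : Measure (Path 𝒳)) (n : ℕ) : ℝ :=
  -(1 / ((n : ℝ) + 1)) *
    ∑' s : Fin (n + 1) → 𝒳,
      pstr μ (n + 1) (fun j => if h : j < n + 1 then s ⟨j, h⟩ else s ⟨0, Nat.succ_pos n⟩) *
        Real.logb 2
          (pstr μ (n + 1) (fun j => if h : j < n + 1 then s ⟨j, h⟩ else s ⟨0, Nat.succ_pos n⟩))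

/-- The process has entropy rate `H`. -/
def HasEntropyRate (μ : Measure (Path 𝒳)) (H : ℝ) : Prop :=
  Tendsto (entropyTerm μ) atTop (nhds H)

/-- The backward stopping times `ζ̂_i^k`. -/
def hatZeta (l : ℕ → ℕ) (k : ℕ) (ω : Path 𝒳) : ℕ → ℤ
  | 0 => 0
  | i + 1 =>
    hatZeta l k ω i -
      ((sInf {t : ℕ | 0 < t ∧ ∀ s < l (k - i),
          ω (hatZeta l k ω i - (s : ℤ) - (t : ℤ)) = ω (hatZeta l k ω i - (s : ℤ))} : ℕ) : ℤ)

/-- Hoeffding's lemma for a centred Bernoulli variable. -/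
lemma bernoulli_mgf_le {q : ℝ} (h0 : 0 ≤ q) (h1 : q ≤ 1) (θ : ℝ) :
    q * Real.exp (θ * (1 - q)) + (1 - q) * Real.exp (θ * (0 - q)) ≤ Real.exp (θ ^ 2 / 8) := by
  set ν : Measure ℝ := ENNReal.ofReal q • Measure.dirac 1 + ENNReal.ofReal (1 - q) • Measure.dirac 0
    with hν
  have hprob : IsProbabilityMeasure ν := ⟨by
    simp [hν, ← ENNReal.ofReal_add h0 (sub_nonneg.2 h1)]⟩
  have hint : ∀ f : ℝ → ℝ, ∫ y, f y ∂ν = q * f 1 + (1 - q) * f 0 := by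
    intro f
    have hd : ∀ a : ℝ, Integrable f (Measure.dirac a) := fun a =>
      integrable_dirac (by simp)
    rw [hν, integral_add_measure ((hd 1).smul_measure ENNReal.ofReal_ne_top)
      ((hd 0).smul_measure ENNReal.ofReal_ne_top), integral_smul_measure, integral_smul_measure,
      integral_dirac, integral_dirac, ENNReal.toReal_ofReal h0,
      ENNReal.toReal_ofReal (sub_nonneg.2 h1)]
    simp
  have hmem : ∀ᵐ y ∂ν, (fun y : ℝ => y) y ∈ Set.Icc (0 : ℝ) 1 := by
    rw [ae_iff]
    simp [hν]
  have hs := (ProbabilityTheory.hasSubgaussianMGF_of_mem_Icc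
    (X := fun y : ℝ => y) measurable_id.aemeasurable hmem).mgf_le θ
  rw [ProbabilityTheory.mgf, hint, hint] at hs
  have e : ((((‖(1 : ℝ) - 0‖₊ / 2) ^ 2 : NNReal) : ℝ) * θ ^ 2 / 2) = θ ^ 2 / 8 := by
    simp; ring
  rw [e] at hs
  simpa using hs

/-- If a weighted difference of two empirical means exceeds `ε`, then one of countably many
exponential functionals is large. -/
lemma exists_exponent_le {ε c τ B C M L : ℝ} (hε : 0 < ε) (hτ : τ = ε ^ 2 * c)
    (hτh : 1 / 2 ≤ τ) (hM : 0 < M) (hcM : c ≤ M) (hL : 0 ≤ L)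
    (h : ε * M * (M + L) < B * L - M * C) :
    2 * τ - 1 ≤ 4 * ε * B - (4 * ε) ^ 2 * M / 8 ∨
    ∃ j : ℕ, 2 * τ + (1 / 2 + j / 4) ≤ 4 * ε * B + (-(2 * ε / τ * (3 / 2) ^ j)) * C
        - (4 * ε) ^ 2 * M / 8 - (-(2 * ε / τ * (3 / 2) ^ j)) ^ 2 * L / 8 := by
  have hτ0 : 0 < τ := by linarith
  obtain ⟨x, rfl⟩ : ∃ x, B = ε * M * (1 - x) := ⟨1 - B / (ε * M), by field_simp; ring⟩
  have hC : C < -(ε * (M + x * L)) := by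
    have : M * C < M * (-(ε * (M + x * L))) := by nlinarith
    exact lt_of_mul_lt_mul_left this hM.le
  have hMτ : τ ≤ ε ^ 2 * M := by rw [hτ]; gcongr
  set P := ε ^ 2 * M with hP
  by_cases hx : x < 1 / (4 * τ)
  · left
    rw [lt_div_iff₀ (by positivity)] at hx
    have e : 4 * ε * (ε * M * (1 - x)) - (4 * ε) ^ 2 * M / 8 = P * (2 - 4 * x) := by
      rw [hP]; ring
    rw [e]
    have h2 : 0 ≤ 2 - 4 * x := by nlinarith
    nlinarith
  · right
    push Not at hx
    rw [div_le_iff₀ (by positivity)] at hx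
    obtain ⟨j, hj1, hj2⟩ := exists_nat_pow_near hx (by norm_num : (1 : ℝ) < 3 / 2)
    refine ⟨j, ?_⟩
    have hb : 1 + (j : ℝ) * (1 / 2) ≤ (3 / 2) ^ j := by
      have := one_add_mul_le_pow (a := (1 / 2 : ℝ)) (by norm_num) j
      norm_num at this ⊢; linarith
    rw [pow_succ] at hj2
    obtain ⟨y, hy⟩ : ∃ y, (3 / 2 : ℝ) ^ j = y * (4 * τ) := ⟨(3 / 2) ^ j / (4 * τ), by field_simp⟩
    rw [hy] at hj1 hj2 hb
    have hyx : y ≤ x := le_of_mul_le_mul_right hj1 (by positivity)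
    have hxy : x < 3 / 2 * y := by
      refine lt_of_mul_lt_mul_right (a := 4 * τ) ?_ (by positivity); linarith
    have hy0 : 0 < y := by linarith
    have e : 2 * ε / τ * (y * (4 * τ)) = 8 * ε * y := by field_simp; ring
    rw [hy, e]
    have h1 : 8 * ε * y * (ε * (M + x * L)) ≤ -(8 * ε * y) * C := by
      have : 0 ≤ 8 * ε * y := by positivity
      nlinarith
    have h2 : 0 ≤ ε ^ 2 * y * L * (x - y) := by
      have := sub_nonneg.2 hyx; positivity
    have h3 : P * (2 + 2 * y) ≤ P * (2 - 4 * x + 8 * y) := by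
      have : 0 ≤ P := by positivity
      apply mul_le_mul_of_nonneg_left _ this; linarith
    have h4 : τ * (2 + 2 * y) ≤ P * (2 + 2 * y) := by gcongr
    have h5 : P * (2 - 4 * x + 8 * y) = 4 * ε * (ε * M * (1 - x)) - (4 * ε) ^ 2 * M / 8
        + 8 * ε * y * (ε * M) := by rw [hP]; ring
    nlinarith

lemma tsum_exp_le (τ : ℝ) :
    ∑' j : ℕ, ENNReal.ofReal (Real.exp (-(2 * τ + (1 / 2 + (j : ℝ) / 4)))) ≤
      ENNReal.ofReal (4 * Real.exp (-(2 * τ))) := by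
  have e : ∀ j : ℕ, Real.exp (-(2 * τ + (1 / 2 + (j : ℝ) / 4))) =
      Real.exp (-(2 * τ)) * Real.exp (-(1 / 2)) * Real.exp (-(1 / 4)) ^ j := by
    intro j
    rw [← Real.exp_nat_mul, ← Real.exp_add, ← Real.exp_add]
    congr 1; ring
  have hr : Real.exp (-(1 / 4)) ≤ 4 / 5 := by
    rw [Real.exp_neg, inv_le_comm₀ (Real.exp_pos _) (by norm_num)]
    have := Real.add_one_le_exp (1 / 4 : ℝ)
    norm_num at this ⊢; linarith
  have hh : Real.exp (-(1 / 2)) ≤ 2 / 3 := by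
    rw [Real.exp_neg, inv_le_comm₀ (Real.exp_pos _) (by norm_num)]
    have := Real.add_one_le_exp (1 / 2 : ℝ)
    norm_num at this ⊢; linarith
  have hg := hasSum_geometric_of_lt_one (Real.exp_pos (-(1 / 4))).le (by linarith)
  simp_rw [e]
  rw [← ENNReal.ofReal_tsum_of_nonneg (fun j => by positivity) (hg.summable.mul_left _),
    tsum_mul_left, hg.tsum_eq]
  apply ENNReal.ofReal_le_ofReal
  have hi : (1 - Real.exp (-(1 / 4)))⁻¹ ≤ 5 := by
    rw [inv_le_comm₀ (by linarith) (by norm_num)]; linarith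
  have h0 : 0 ≤ (1 - Real.exp (-(1 / 4)))⁻¹ := inv_nonneg.2 (by linarith)
  have hp := Real.exp_pos (-(2 * τ))
  calc _ ≤ Real.exp (-(2 * τ)) * (2 / 3) * 5 := by gcongr
    _ ≤ _ := by linarith

/-- The block of length `m` of `ω` ending at time `T`, read right-to-left. -/
def block {𝒳 : Type*} (T : ℤ) (m : ℕ) (ω : Path 𝒳) : Fin m → 𝒳 := fun j => ω (T - (j : ℕ))

lemma block_eq_iff {𝒳 : Type*} {T : ℤ} {m : ℕ} {ω : Path 𝒳} {s : ℕ → 𝒳} :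
    block T m ω = (fun j : Fin m => s j) ↔ OccursAt ω m s T :=
  ⟨fun h j hj => congrFun h ⟨j, hj⟩, fun h => funext fun j => h j j.2⟩

lemma occursAt_withLast {𝒳 : Type*} {ω : Path 𝒳} {m : ℕ} {x : 𝒳} {s : ℕ → 𝒳} {t : ℤ} :
    OccursAt ω (m + 1) (withLast x s) (t + 1) ↔ ω (t + 1) = x ∧ OccursAt ω m s t := by
  constructor
  · intro h
    refine ⟨by simpa [withLast] using h 0 (by omega), fun j hj => ?_⟩
    have := h (j + 1) (by omega)
    simp only [withLast, Nat.add_eq_zero_iff, one_ne_zero, and_false, if_false,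
      Nat.add_sub_cancel] at this
    rw [← this]; congr 1; push_cast; ring
  · rintro ⟨h1, h2⟩ j hj
    rcases j with _ | j
    · simpa [withLast] using h1
    · have := h2 j (by omega)
      simp only [withLast, Nat.add_eq_zero_iff, one_ne_zero, and_false, if_false,
        Nat.add_sub_cancel]
      rw [← this]; congr 1; push_cast; ring

lemma OccursAt.congr {𝒳 : Type*} {ω : Path 𝒳} {m : ℕ} {s s' : ℕ → 𝒳} {t : ℤ}
    (h : ∀ j < m, s j = s' j) :
    OccursAt ω m s t ↔ OccursAt ω m s' t :=
  forall₂_congr fun j hj => by rw [h j hj]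

lemma measurable_block (T : ℤ) (m : ℕ) : Measurable (block T m : Path 𝒳 → Fin m → 𝒳) :=
  measurable_pi_lambda _ fun _ => measurable_pi_apply _

lemma measurableSet_occursAt [Countable 𝒳] [MeasurableSingletonClass 𝒳]
    (m : ℕ) (s : ℕ → 𝒳) (t : ℤ) :
    MeasurableSet {ω : Path 𝒳 | OccursAt ω m s t} := by
  have : {ω : Path 𝒳 | OccursAt ω m s t} = block t m ⁻¹' {fun j : Fin m => s j} := by
    ext ω; exact block_eq_iff.symm
  rw [this]
  exact measurable_block t m (measurableSet_singleton _)

lemma measurableSet_coord [MeasurableSingletonClass 𝒳] (t : ℤ) (x : 𝒳) :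
    MeasurableSet {ω : Path 𝒳 | ω t = x} :=
  (measurable_pi_apply (X := fun _ : ℤ => 𝒳) t) (measurableSet_singleton x)

lemma measure_shift_time {μ : Measure (Path 𝒳)}
    (hμ : MeasurePreserving (shift : Path 𝒳 → Path 𝒳) μ μ)
    {S : ℤ → Set (Path 𝒳)} (hS : ∀ t, MeasurableSet (S t))
    (hshift : ∀ t, shift ⁻¹' S t = S (t + 1)) (T : ℕ) : μ (S T) = μ (S 0) := by
  induction T with
  | zero => simp
  | succ T ih =>
    rw [← ih]
    push_cast
    rw [← hshift, hμ.measure_preimage (hS _).nullMeasurableSet]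

lemma tsum_measure_inter_block [Countable 𝒳] [MeasurableSingletonClass 𝒳] (μ : Measure (Path 𝒳))
    (T : ℤ) (m : ℕ) {V : Set (Path 𝒳)} (hV : MeasurableSet V) :
    ∑' c, μ (V ∩ block T m ⁻¹' {c}) = μ V := by
  rw [← measure_iUnion
    (fun c d hcd => (Disjoint.preimage _ (Set.disjoint_singleton.2 hcd)).mono
      inter_subset_right inter_subset_right)
    (fun c => hV.inter (measurable_block T m (measurableSet_singleton c))),
    ← inter_iUnion, ← preimage_iUnion, iUnion_of_singleton, preimage_univ, inter_univ]

lemma pcond_eq (μ : Measure (Path 𝒳)) (m : ℕ) (x : 𝒳) (s : ℕ → 𝒳) :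
    pcond μ m x s = (μ {ω | ω (0 + 1) = x ∧ OccursAt ω m s 0}).toReal /
      (μ {ω | OccursAt ω m s 0}).toReal := by
  simp [pcond, pstr, OccursAt]

lemma pcond_nonneg (μ : Measure (Path 𝒳)) (m : ℕ) (x : 𝒳) (s : ℕ → 𝒳) : 0 ≤ pcond μ m x s :=
  div_nonneg ENNReal.toReal_nonneg ENNReal.toReal_nonneg

lemma pcond_le_one (μ : Measure (Path 𝒳)) [IsFiniteMeasure μ] (m : ℕ) (x : 𝒳) (s : ℕ → 𝒳) :
    pcond μ m x s ≤ 1 := by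
  rw [pcond_eq]
  refine div_le_one_of_le₀ (ENNReal.toReal_mono (measure_ne_top _ _) ?_) ENNReal.toReal_nonneg
  exact measure_mono fun ω h => h.2

lemma measure_eq_pcond_mul (μ : Measure (Path 𝒳)) [IsFiniteMeasure μ] (m : ℕ) (x : 𝒳)
    (s : ℕ → 𝒳) :
    μ {ω | ω (0 + 1) = x ∧ OccursAt ω m s 0} =
      ENNReal.ofReal (pcond μ m x s) * μ {ω | OccursAt ω m s 0} := by
  have hle : μ {ω | ω (0 + 1) = x ∧ OccursAt ω m s 0} ≤ μ {ω | OccursAt ω m s 0} :=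
    measure_mono fun ω h => h.2
  rw [pcond_eq]
  by_cases h0 : μ {ω | OccursAt ω m s 0} = 0
  · rw [h0] at hle ⊢
    simpa using hle
  · rw [← ENNReal.toReal_div, ENNReal.ofReal_toReal
      (ENNReal.div_ne_top (measure_ne_top _ _) h0),
      ENNReal.div_mul_cancel h0 (measure_ne_top _ _)]

lemma pcond_congr (μ : Measure (Path 𝒳)) {m : ℕ} (x : 𝒳) {s s' : ℕ → 𝒳}
    (h : ∀ j < m, s j = s' j) : pcond μ m x s = pcond μ m x s' := by
  simp_rw [pcond_eq, OccursAt.congr h]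

lemma measure_occursAt_time [Countable 𝒳] [MeasurableSingletonClass 𝒳] {μ : Measure (Path 𝒳)}
    (hμ : MeasurePreserving (shift : Path 𝒳 → Path 𝒳) μ μ) (m : ℕ) (s : ℕ → 𝒳) (T : ℕ) :
    μ {ω | OccursAt ω m s T} = μ {ω | OccursAt ω m s 0} := by
  refine measure_shift_time hμ (S := fun t => {ω | OccursAt ω m s t})
    (measurableSet_occursAt m s) (fun t => ?_) T
  ext ω
  refine forall₂_congr fun j _ => ?_
  simp only [shift]
  rw [show t + 1 - (j : ℤ) = t - j + 1 by ring]

lemma measure_occursAt_next_time [Countable 𝒳] [MeasurableSingletonClass 𝒳]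
    {μ : Measure (Path 𝒳)} (hμ : MeasurePreserving (shift : Path 𝒳 → Path 𝒳) μ μ) (m : ℕ)
    (x : 𝒳) (s : ℕ → 𝒳) (T : ℕ) :
    μ {ω | ω ((T : ℤ) + 1) = x ∧ OccursAt ω m s T} =
      μ {ω | ω (0 + 1) = x ∧ OccursAt ω m s 0} := by
  refine measure_shift_time hμ (S := fun t => {ω | ω (t + 1) = x ∧ OccursAt ω m s t})
    (fun t => (measurableSet_coord _ _).inter (measurableSet_occursAt m s t)) (fun t => ?_) T
  ext ω
  refine and_congr Iff.rfl (forall₂_congr fun j _ => ?_)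
  simp only [shift]
  rw [show t + 1 - (j : ℤ) = t - j + 1 by ring]

lemma pstr_withLast [Countable 𝒳] [MeasurableSingletonClass 𝒳] {μ : Measure (Path 𝒳)}
    (hμ : MeasurePreserving (shift : Path 𝒳 → Path 𝒳) μ μ) (m : ℕ) (x : 𝒳) (s : ℕ → 𝒳) :
    pstr μ (m + 1) (withLast x s) = (μ {ω | ω (0 + 1) = x ∧ OccursAt ω m s 0}).toReal := by
  have h := measure_occursAt_time hμ (m + 1) (withLast x s) 1
  simp only [pstr, ← occursAt_withLast]
  simp only [OccursAt, zero_sub, zero_add, Nat.cast_one] at h ⊢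
  rw [h]

/-- Beyond a memory bound, every longer past gives the same conditional probability. -/
lemma IsMemoryBound.measure_next [Countable 𝒳] [MeasurableSingletonClass 𝒳]
    {μ : Measure (Path 𝒳)} [IsFiniteMeasure μ]
    (hμ : MeasurePreserving (shift : Path 𝒳 → Path 𝒳) μ μ) {σ : ℕ → 𝒳} {k : ℕ}
    (hσ : IsMemoryBound μ σ k) (x : 𝒳) {m : ℕ} (hkm : k ≤ m) {r : ℕ → 𝒳}
    (hr : ∀ j < k, r j = σ j) :
    μ {ω | ω (0 + 1) = x ∧ OccursAt ω m r 0} =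
      ENNReal.ofReal (pcond μ k x σ) * μ {ω | OccursAt ω m r 0} := by
  set q := pcond μ k x σ with hq
  have hle : ∀ r : ℕ → 𝒳, (∀ j < k, r j = σ j) →
      μ {ω | ω (0 + 1) = x ∧ OccursAt ω m r 0} ≤
        ENNReal.ofReal q * μ {ω | OccursAt ω m r 0} := by
    intro r hr
    rcases hkm.eq_or_lt with rfl | hlt
    · rw [measure_eq_pcond_mul, hq, pcond_congr μ x hr]
    obtain ⟨i, rfl⟩ := Nat.exists_eq_add_of_lt hlt
    have hrp : prependOld σ k (fun j => r (j + k)) = r := by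
      funext j
      simp only [prependOld]
      split_ifs with h
      · exact (hr j h).symm
      · rw [Nat.sub_add_cancel (not_lt.1 h)]
    by_cases h0 : μ {ω | ω (0 + 1) = x ∧ OccursAt ω (k + i + 1) r 0} = 0
    · exact h0.le.trans (by positivity)
    · have := hσ (i + 1) (by omega) x (fun j => r (j + k)) (by
        rw [hrp, ← add_assoc, pstr_withLast hμ]
        exact ENNReal.toReal_pos h0 (measure_ne_top _ _))
      rw [hrp, ← add_assoc] at this
      rw [measure_eq_pcond_mul, hq, this]
  set W : Set (Path 𝒳) := {ω | OccursAt ω k σ 0} with hW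
  set U : Set (Path 𝒳) := {ω | ω (0 + 1) = x} with hU
  have hpart : ∀ V : Set (Path 𝒳), MeasurableSet V →
      ∑' c, μ (V ∩ block 0 m ⁻¹' {c}) = μ V := fun V hV => tsum_measure_inter_block μ 0 m hV
  have hWm : MeasurableSet W := measurableSet_occursAt k σ 0
  have hUW : MeasurableSet (U ∩ W) := (measurableSet_coord _ _).inter hWm
  have hfib : ∀ r : ℕ → 𝒳, (∀ j < k, r j = σ j) →
      W ∩ block 0 m ⁻¹' {fun j : Fin m => r j} = {ω | OccursAt ω m r 0} := by
    intro r hr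
    ext ω
    constructor
    · rintro ⟨-, h⟩; exact block_eq_iff.1 h
    · intro h
      exact ⟨fun j hj => (h j (by omega)).trans (hr j hj), block_eq_iff.2 h⟩
  have hle' : ∀ c : Fin m → 𝒳, μ ((U ∩ W) ∩ block 0 m ⁻¹' {c}) ≤
      ENNReal.ofReal q * μ (W ∩ block 0 m ⁻¹' {c}) := by
    intro c
    rcases (W ∩ block 0 m ⁻¹' {c}).eq_empty_or_nonempty with he | ⟨ω₀, h1, h2⟩
    · rw [inter_assoc, he]; simp
    · have hc : c = fun j : Fin m => ω₀ (0 - ((j : ℕ) : ℤ)) := by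
        rw [← (show block 0 m ω₀ = c from h2)]; rfl
      have hr' : ∀ j < k, (fun j : ℕ => ω₀ (0 - (j : ℤ))) j = σ j := fun j hj => h1 j hj
      have := hle _ hr'
      rw [inter_assoc, hc, hfib _ hr']
      exact this
  have htop : ∑' c, μ ((U ∩ W) ∩ block 0 m ⁻¹' {c}) ≠ ⊤ := by
    rw [hpart _ hUW]; exact measure_ne_top _ _
  have hsum : ∑' c, μ ((U ∩ W) ∩ block 0 m ⁻¹' {c}) =
      ∑' c, ENNReal.ofReal q * μ (W ∩ block 0 m ⁻¹' {c}) := by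
    rw [ENNReal.tsum_mul_left, hpart _ hUW, hpart _ hWm]
    exact measure_eq_pcond_mul μ k x σ
  have key : μ ((U ∩ W) ∩ block 0 m ⁻¹' {fun j : Fin m => r j}) =
      ENNReal.ofReal q * μ (W ∩ block 0 m ⁻¹' {fun j : Fin m => r j}) := by
    by_contra hne
    exact (ENNReal.tsum_lt_tsum htop hle' (lt_of_le_of_ne (hle' _) hne)).ne hsum
  rw [inter_assoc, hfib r hr] at key
  exact key

open Classical in
/-- The indicator of the event `X_{t+1} = x`. -/
def hit {𝒳 : Type*} (x : 𝒳) (t : ℤ) (ω : Path 𝒳) : ℝ := if ω (t + 1) = x then 1 else 0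

lemma dependsOn_block {𝒳 : Type*} {α : Type*} {T : ℕ} {f : Path 𝒳 → α}
    (hf : DependsOn f (Set.Icc (0 : ℤ) T)) {ω ω' : Path 𝒳}
    (h : block T (T + 1) ω = block T (T + 1) ω') : f ω = f ω' := by
  refine hf fun i hi => ?_
  have hi0 := hi.1
  have hi1 := hi.2
  have := congrFun h ⟨((T : ℤ) - i).toNat, by omega⟩
  simp only [block] at this
  rw [Int.toNat_of_nonneg (by omega), sub_sub_cancel] at this
  exact this

/-- One step of the exponential supermartingale: multiplying by a tilted centred bit, which is a
Bernoulli variable given the past whenever the tilt does not vanish, does not increase the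
integral. -/
lemma lintegral_mul_exp_le [Countable 𝒳] [MeasurableSingletonClass 𝒳] {μ : Measure (Path 𝒳)}
    [IsFiniteMeasure μ] (hμ : MeasurePreserving (shift : Path 𝒳 → Path 𝒳) μ μ) {σ : ℕ → 𝒳}
    {k : ℕ} (hσ : IsMemoryBound μ σ k) (x : 𝒳) {T : ℕ} {f : Path 𝒳 → ℝ≥0∞} {θ : Path 𝒳 → ℝ}
    (hf : DependsOn f (Set.Icc (0 : ℤ) T)) (hθ : DependsOn θ (Set.Icc (0 : ℤ) T))
    (hsupp : ∀ ω, θ ω ≠ 0 → k ≤ T + 1 ∧ OccursAt ω k σ T) :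
    ∫⁻ ω, f ω * ENNReal.ofReal
        (Real.exp (θ ω * (hit x T ω - pcond μ k x σ) - θ ω ^ 2 / 8)) ∂μ ≤ ∫⁻ ω, f ω ∂μ := by
  set q := pcond μ k x σ with hq
  have hq0 : 0 ≤ q := pcond_nonneg μ k x σ
  have hq1 : q ≤ 1 := pcond_le_one μ k x σ
  have hPm : ∀ c : Fin (T + 1) → 𝒳, MeasurableSet (block (T : ℤ) (T + 1) ⁻¹' {c}) := fun c =>
    measurable_block T (T + 1) (measurableSet_singleton c)
  have key : ∀ F : Path 𝒳 → ℝ≥0∞,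
      ∫⁻ ω, F ω ∂μ = ∑' c, ∫⁻ ω in block (T : ℤ) (T + 1) ⁻¹' {c}, F ω ∂μ := by
    intro F
    rw [← lintegral_iUnion hPm
      (fun c d hcd => Disjoint.preimage _ (Set.disjoint_singleton.2 hcd)),
      ← preimage_iUnion, iUnion_of_singleton, preimage_univ, Measure.restrict_univ]
  rw [key, key f]
  refine ENNReal.tsum_le_tsum fun c => ?_
  rcases (block (T : ℤ) (T + 1) ⁻¹' {c} : Set (Path 𝒳)).eq_empty_or_nonempty with he | ⟨ω₀, h₀⟩
  · simp [he]
  have hc : c = fun j : Fin (T + 1) => ω₀ (T - ((j : ℕ) : ℤ)) := by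
    rw [← (show block (T : ℤ) (T + 1) ω₀ = c from h₀)]; rfl
  have hfc : ∀ ω ∈ (block (T : ℤ) (T + 1) ⁻¹' {c} : Set (Path 𝒳)), f ω = f ω₀ :=
    fun ω hω => dependsOn_block hf (hω.trans h₀.symm)
  have hθc : ∀ ω ∈ (block (T : ℤ) (T + 1) ⁻¹' {c} : Set (Path 𝒳)), θ ω = θ ω₀ :=
    fun ω hω => dependsOn_block hθ (hω.trans h₀.symm)
  rcases eq_or_ne (θ ω₀) 0 with hz | hz
  · refine (setLIntegral_congr_fun (hPm c) fun ω hω => ?_).le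
    simp [hθc ω hω, hz]
  obtain ⟨hkT, hocc⟩ := hsupp ω₀ hz
  set P : Set (Path 𝒳) := block (T : ℤ) (T + 1) ⁻¹' {c} with hP
  set U : Set (Path 𝒳) := {ω | ω ((T : ℤ) + 1) = x} with hU
  have hUm : MeasurableSet U := measurableSet_coord _ _
  have hPocc : P = {ω | OccursAt ω (T + 1) (fun j => ω₀ (T - (j : ℤ))) T} := by
    ext ω
    rw [hP, hc]
    exact block_eq_iff (s := fun j => ω₀ (T - (j : ℤ)))
  have hPU : μ (P ∩ U) = ENNReal.ofReal q * μ P := by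
    have h1 := measure_occursAt_next_time hμ (T + 1) x (fun j => ω₀ (T - (j : ℤ))) T
    have h2 := measure_occursAt_time hμ (T + 1) (fun j => ω₀ (T - (j : ℤ))) T
    rw [hσ.measure_next hμ x hkT (fun j hj => hocc j hj), ← h2, ← hPocc] at h1
    rw [← h1, inter_comm, hPocc]
    rfl
  have hPd : μ (P \ U) = ENNReal.ofReal (1 - q) * μ P := by
    have h := measure_inter_add_sdiff (μ := μ) P hUm
    have e : μ P = ENNReal.ofReal q * μ P + ENNReal.ofReal (1 - q) * μ P := by
      rw [← add_mul, ← ENNReal.ofReal_add hq0 (sub_nonneg.2 hq1)]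
      simp
    rw [hPU] at h
    nth_rewrite 2 [e] at h
    exact (ENNReal.add_right_inj
      (ENNReal.mul_ne_top ENNReal.ofReal_ne_top (measure_ne_top _ _))).1 h
  set a := θ ω₀ with ha
  rw [← lintegral_inter_add_sdiff _ P hUm]
  have h1 : ∫⁻ ω in P ∩ U, f ω * ENNReal.ofReal
      (Real.exp (θ ω * (hit x T ω - q) - θ ω ^ 2 / 8)) ∂μ =
      f ω₀ * ENNReal.ofReal (Real.exp (a * (1 - q) - a ^ 2 / 8)) * μ (P ∩ U) := by
    rw [← setLIntegral_const]
    refine setLIntegral_congr_fun ((hPm c).inter hUm) fun ω hω => ?_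
    have : hit x T ω = 1 := if_pos hω.2
    simp only [hfc ω hω.1, hθc ω hω.1, this]
  have h2 : ∫⁻ ω in P \ U, f ω * ENNReal.ofReal
      (Real.exp (θ ω * (hit x T ω - q) - θ ω ^ 2 / 8)) ∂μ =
      f ω₀ * ENNReal.ofReal (Real.exp (a * (0 - q) - a ^ 2 / 8)) * μ (P \ U) := by
    rw [← setLIntegral_const]
    refine setLIntegral_congr_fun ((hPm c).diff hUm) fun ω hω => ?_
    have : hit x T ω = 0 := if_neg hω.2
    simp only [hfc ω hω.1, hθc ω hω.1, this]
  rw [h1, h2, hPU, hPd, setLIntegral_congr_fun (hPm c) hfc, setLIntegral_const]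
  have hb : q * Real.exp (a * (1 - q) - a ^ 2 / 8) +
      (1 - q) * Real.exp (a * (0 - q) - a ^ 2 / 8) ≤ 1 := by
    have := bernoulli_mgf_le hq0 hq1 a
    rw [sub_eq_add_neg (a * (1 - q)), sub_eq_add_neg (a * (0 - q)), Real.exp_add, Real.exp_add]
    have h3 : Real.exp (a ^ 2 / 8) * Real.exp (-(a ^ 2 / 8)) = 1 := by
      rw [← Real.exp_add]; simp
    have h4 := mul_le_mul_of_nonneg_right this (Real.exp_pos (-(a ^ 2 / 8))).le
    linarith
  calc _ = f ω₀ * μ P * ENNReal.ofReal (q * Real.exp (a * (1 - q) - a ^ 2 / 8) +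
      (1 - q) * Real.exp (a * (0 - q) - a ^ 2 / 8)) := by
        rw [ENNReal.ofReal_add (by positivity)
          (mul_nonneg (sub_nonneg.2 hq1) (Real.exp_pos _).le), ENNReal.ofReal_mul hq0,
          ENNReal.ofReal_mul (sub_nonneg.2 hq1)]
        ring
    _ ≤ f ω₀ * μ P * ENNReal.ofReal 1 := by gcongr
    _ = _ := by rw [ENNReal.ofReal_one, mul_one]

lemma lintegral_exp_sum_le [Countable 𝒳] [MeasurableSingletonClass 𝒳] {μ : Measure (Path 𝒳)}
    [IsFiniteMeasure μ] (hμ : MeasurePreserving (shift : Path 𝒳 → Path 𝒳) μ μ) {σ : ℕ → 𝒳}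
    {k : ℕ} (hσ : IsMemoryBound μ σ k) (x : 𝒳) {θ : ℕ → Path 𝒳 → ℝ}
    (hθ : ∀ t, DependsOn (θ t) (Set.Icc (0 : ℤ) t))
    (hsupp : ∀ t ω, θ t ω ≠ 0 → k ≤ t + 1 ∧ OccursAt ω k σ t)
    {H : ℕ} {A : Set (Path 𝒳)} (hAm : MeasurableSet A)
    (hA : DependsOn (fun ω => ω ∈ A) (Set.Icc (0 : ℤ) H)) {T : ℕ} (hHT : H ≤ T) :
    ∫⁻ ω in A, ENNReal.ofReal (Real.exp (∑ t ∈ Finset.Ico H T,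
      (θ t ω * (hit x t ω - pcond μ k x σ) - θ t ω ^ 2 / 8))) ∂μ ≤ μ A := by
  classical
  rw [← lintegral_indicator hAm]
  set Z : ℕ → Path 𝒳 → ℝ≥0∞ := fun T => A.indicator fun ω => ENNReal.ofReal (Real.exp
    (∑ t ∈ Finset.Ico H T, (θ t ω * (hit x t ω - pcond μ k x σ) - θ t ω ^ 2 / 8))) with hZ
  have hdep : ∀ T, H ≤ T → DependsOn (Z T) (Set.Icc (0 : ℤ) T) := by
    intro T hT ω ω' h
    have hAi : (ω ∈ A) = (ω' ∈ A) := hA fun i hi => h i ⟨hi.1, by have := hi.2; omega⟩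
    have hs : ∑ t ∈ Finset.Ico H T, (θ t ω * (hit x t ω - pcond μ k x σ) - θ t ω ^ 2 / 8) =
        ∑ t ∈ Finset.Ico H T, (θ t ω' * (hit x t ω' - pcond μ k x σ) - θ t ω' ^ 2 / 8) := by
      refine Finset.sum_congr rfl fun t ht => ?_
      rw [Finset.mem_Ico] at ht
      have h1 : θ t ω = θ t ω' := hθ t fun i hi => h i ⟨hi.1, by have := hi.2; omega⟩
      have h2 : ω ((t : ℤ) + 1) = ω' ((t : ℤ) + 1) := h _ ⟨by omega, by omega⟩
      simp only [hit, h1, h2]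
    simp only [hZ, Set.indicator_apply, hAi, hs]
  change ∫⁻ ω, Z T ω ∂μ ≤ μ A
  induction T, hHT using Nat.le_induction with
  | base => simp [hZ, lintegral_indicator hAm]
  | succ T hT ih =>
    refine le_trans (le_of_eq ?_)
      ((lintegral_mul_exp_le hμ hσ x (hdep T hT) (hθ T) (hsupp T)).trans ih)
    refine lintegral_congr fun ω => ?_
    by_cases hω : ω ∈ A
    · simp only [hZ, Set.indicator_of_mem hω, Finset.sum_Ico_succ_top hT, Real.exp_add]
      rw [ENNReal.ofReal_mul (Real.exp_pos _).le]
    · simp [hZ, hω]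

open Classical in
/-- The indicator that `s`, of length `m`, ends at `t` in the window used by `empCond`. -/
def visit {𝒳 : Type*} (n m : ℕ) (s : ℕ → 𝒳) (t : ℕ) (ω : Path 𝒳) : ℝ :=
  if half n + m ≤ t + 1 ∧ OccursAt ω m s t then 1 else 0

lemma visit_eq_zero_or_one {𝒳 : Type*} (n m : ℕ) (s : ℕ → 𝒳) (t : ℕ) (ω : Path 𝒳) :
    visit n m s t ω = 0 ∨ visit n m s t ω = 1 := by
  unfold visit; split_ifs <;> simp

lemma hit_eq_zero_or_one {𝒳 : Type*} (x : 𝒳) (t : ℤ) (ω : Path 𝒳) :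
    hit x t ω = 0 ∨ hit x t ω = 1 := by
  unfold hit; split_ifs <;> simp

lemma visit_of_visit_add {𝒳 : Type*} {n m i : ℕ} {s : ℕ → 𝒳} {t : ℕ} {ω : Path 𝒳}
    (h : visit n (m + i) s t ω = 1) : visit n m s t ω = 1 := by
  unfold visit at h ⊢
  split_ifs at h with h'
  · exact if_pos ⟨by omega, fun j hj => h'.2 j (by omega)⟩
  · simp at h

lemma dependsOn_visit {𝒳 : Type*} (n m : ℕ) (s : ℕ → 𝒳) (t : ℕ) :
    DependsOn (visit n m s t) (Set.Icc (0 : ℤ) t) := by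
  classical
  intro ω ω' h
  unfold visit
  refine if_congr (and_congr_right fun hm => forall₂_congr fun j hj => ?_) rfl rfl
  rw [h _ ⟨by omega, by omega⟩]

lemma measurable_visit [Countable 𝒳] [MeasurableSingletonClass 𝒳] (n m : ℕ) (s : ℕ → 𝒳) (t : ℕ) :
    Measurable (visit n m s t) :=
  Measurable.ite ((MeasurableSet.const _).inter (measurableSet_occursAt m s t))
    measurable_const measurable_const

lemma measurable_hit [MeasurableSingletonClass 𝒳] (x : 𝒳) (t : ℤ) : Measurable (hit x t) :=
  Measurable.ite (measurableSet_coord _ _) measurable_const measurable_const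

lemma cnt_eq_sum_visit {𝒳 : Type*} {n : ℕ} (hn : 0 < n) (m : ℕ) (s : ℕ → 𝒳) (ω : Path 𝒳) :
    (cnt ω m s ((half n : ℤ) + m - 1) ((n : ℤ) - 1) : ℝ) =
      ∑ t ∈ Finset.Ico (half n - 1) n, visit n m s t ω := by
  classical
  unfold visit
  have hh : 0 < half n := by unfold half; omega
  rw [← Finset.sum_filter, Finset.sum_const, nsmul_one, cnt]
  congr 1
  symm
  refine Finset.card_nbij (fun t : ℕ => (t : ℤ)) ?_ (fun a _ b _ h => by simpa using h) ?_
  · intro t ht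
    simp only [Finset.coe_filter, Finset.mem_Ico, Finset.mem_Icc, mem_ofPred_eq] at ht ⊢
    exact ⟨by omega, ht.2.2⟩
  · intro t ht
    simp only [Finset.coe_filter, Finset.mem_Icc, mem_ofPred_eq] at ht
    obtain ⟨t, rfl⟩ := Int.eq_ofNat_of_zero_le (a := t) (by omega)
    refine ⟨t, ?_, rfl⟩
    simp only [Finset.coe_filter, Finset.mem_Ico, mem_ofPred_eq]
    exact ⟨by omega, by omega, ht.2⟩

lemma cnt_withLast_eq_sum {𝒳 : Type*} {n : ℕ} (hn : 0 < n) (m : ℕ) (x : 𝒳) (s : ℕ → 𝒳)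
    (ω : Path 𝒳) :
    (cnt ω (m + 1) (withLast x s) ((half n : ℤ) + m) n : ℝ) =
      ∑ t ∈ Finset.Ico (half n - 1) n, visit n m s t ω * hit x t ω := by
  classical
  have hh : 0 < half n := by unfold half; omega
  have e : ∀ t : ℕ, visit n m s t ω * hit x t ω =
      if half n + m ≤ t + 1 ∧ OccursAt ω (m + 1) (withLast x s) ((t : ℤ) + 1) then 1 else 0 := by
    intro t
    unfold visit hit
    rw [occursAt_withLast]
    split_ifs <;> simp_all
  simp_rw [e]
  rw [← Finset.sum_filter, Finset.sum_const, nsmul_one, cnt]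
  congr 1
  symm
  refine Finset.card_nbij (fun t : ℕ => (t : ℤ) + 1) ?_ (fun a _ b _ h => by simpa using h) ?_
  · intro t ht
    simp only [Finset.coe_filter, Finset.mem_Ico, Finset.mem_Icc, mem_ofPred_eq] at ht ⊢
    exact ⟨by omega, ht.2.2⟩
  · intro t ht
    simp only [Finset.coe_filter, Finset.mem_Icc, mem_ofPred_eq] at ht
    obtain ⟨u, hu⟩ := Int.eq_ofNat_of_zero_le (a := t - 1) (by omega)
    obtain rfl : t = (u : ℤ) + 1 := by omega
    refine ⟨u, ?_, rfl⟩
    simp only [Finset.coe_filter, Finset.mem_Ico, mem_ofPred_eq]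
    exact ⟨by omega, by omega, ht.2⟩

/-- Number of visits to the string `s` of length `m`. -/
def visits {𝒳 : Type*} (n m : ℕ) (s : ℕ → 𝒳) (ω : Path 𝒳) : ℝ :=
  ∑ t ∈ Finset.Ico (half n - 1) n, visit n m s t ω

/-- Number of visits to the string `s` of length `m` that are followed by `x`. -/
def hits {𝒳 : Type*} (n m : ℕ) (x : 𝒳) (s : ℕ → 𝒳) (ω : Path 𝒳) : ℝ :=
  ∑ t ∈ Finset.Ico (half n - 1) n, visit n m s t ω * hit x t ω

lemma hits_le_visits {𝒳 : Type*} (n m : ℕ) (x : 𝒳) (s : ℕ → 𝒳) (ω : Path 𝒳) :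
    hits n m x s ω ≤ visits n m s ω :=
  Finset.sum_le_sum fun t _ => by
    rcases visit_eq_zero_or_one n m s t ω with h | h <;>
      rcases hit_eq_zero_or_one x t ω with h' | h' <;> simp [h, h']

lemma visits_add_le {𝒳 : Type*} (n m i : ℕ) (s : ℕ → 𝒳) (ω : Path 𝒳) :
    visits n (m + i) s ω ≤ visits n m s ω :=
  Finset.sum_le_sum fun t _ => by
    rcases visit_eq_zero_or_one n (m + i) s t ω with h | h
    · rcases visit_eq_zero_or_one n m s t ω with h' | h' <;> simp [h, h']
    · rw [h, visit_of_visit_add h]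

/-- Chernoff bound for a linear combination of the centred hit counts over the visits to the long
string and over the remaining visits to the short one. -/
lemma measure_exponent_le [Countable 𝒳] [MeasurableSingletonClass 𝒳] {μ : Measure (Path 𝒳)}
    [IsFiniteMeasure μ] (hμ : MeasurePreserving (shift : Path 𝒳 → Path 𝒳) μ μ) {σ : ℕ → 𝒳}
    {k : ℕ} (hσ : IsMemoryBound μ σ k) (x : 𝒳) (i : ℕ) {n : ℕ} (hn : 0 < n)
    {A : Set (Path 𝒳)} (hAm : MeasurableSet A)
    (hA : DependsOn (fun ω => ω ∈ A) (Set.Icc (0 : ℤ) (half n - 1 : ℕ))) (a b κ : ℝ) :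
    μ (A ∩ {ω | κ ≤
      a * (hits n (k + i) x σ ω - pcond μ k x σ * visits n (k + i) σ ω) +
      b * ((hits n k x σ ω - hits n (k + i) x σ ω) -
        pcond μ k x σ * (visits n k σ ω - visits n (k + i) σ ω)) -
      a ^ 2 * visits n (k + i) σ ω / 8 -
      b ^ 2 * (visits n k σ ω - visits n (k + i) σ ω) / 8}) ≤
      ENNReal.ofReal (Real.exp (-κ)) * μ A := by
  set q := pcond μ k x σ with hq
  set θ : ℕ → Path 𝒳 → ℝ := fun t ω =>
    a * visit n (k + i) σ t ω + b * (visit n k σ t ω - visit n (k + i) σ t ω) with hθ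
  have hH : half n - 1 ≤ n := by unfold half; omega
  have hh : 0 < half n := by unfold half; omega
  have hθd : ∀ t, DependsOn (θ t) (Set.Icc (0 : ℤ) t) := fun t ω ω' h => by
    simp only [hθ, dependsOn_visit n (k + i) σ t h, dependsOn_visit n k σ t h]
  have hsupp : ∀ t ω, θ t ω ≠ 0 → k ≤ t + 1 ∧ OccursAt ω k σ t := by
    intro t ω h
    have h1 : visit n k σ t ω = 1 := by
      refine (visit_eq_zero_or_one n k σ t ω).resolve_left fun h0 => h ?_
      have : visit n (k + i) σ t ω = 0 :=
        (visit_eq_zero_or_one n (k + i) σ t ω).resolve_right fun h2 => by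
          rw [visit_of_visit_add h2] at h0; simp at h0
      simp [hθ, h0, this]
    unfold visit at h1
    split_ifs at h1 with h2
    · exact ⟨by omega, h2.2⟩
    · simp at h1
  have hsum : ∀ ω, ∑ t ∈ Finset.Ico (half n - 1) n,
      (θ t ω * (hit x t ω - q) - θ t ω ^ 2 / 8) =
      a * (hits n (k + i) x σ ω - q * visits n (k + i) σ ω) +
      b * ((hits n k x σ ω - hits n (k + i) x σ ω) -
        q * (visits n k σ ω - visits n (k + i) σ ω)) -
      a ^ 2 * visits n (k + i) σ ω / 8 -
      b ^ 2 * (visits n k σ ω - visits n (k + i) σ ω) / 8 := by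
    intro ω
    simp only [hits, visits, Finset.mul_sum, ← Finset.sum_sub_distrib, ← Finset.sum_add_distrib,
      Finset.sum_div]
    refine Finset.sum_congr rfl fun t _ => ?_
    rcases visit_eq_zero_or_one n (k + i) σ t ω with h | h
    · rcases visit_eq_zero_or_one n k σ t ω with h' | h' <;> simp only [hθ, h, h'] <;> ring
    · simp only [hθ, h, visit_of_visit_add h]; ring
  simp_rw [← hsum]
  have hmeas : Measurable fun ω => ENNReal.ofReal (Real.exp (∑ t ∈ Finset.Ico (half n - 1) n,
      (θ t ω * (hit x t ω - q) - θ t ω ^ 2 / 8))) := by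
    refine (Real.measurable_exp.comp (Finset.measurable_sum _ fun t _ => ?_)).ennreal_ofReal
    have h1 := measurable_visit (𝒳 := 𝒳) n (k + i) σ t
    have h2 := measurable_visit (𝒳 := 𝒳) n k σ t
    have h3 := measurable_hit (𝒳 := 𝒳) x t
    have h4 : Measurable (θ t) := (h1.const_mul a).add ((h2.sub h1).const_mul b)
    exact (h4.mul (h3.sub measurable_const)).sub ((h4.pow_const 2).div_const 8)
  have hmain := lintegral_exp_sum_le hμ hσ x hθd hsupp hAm hA hH
  have hmark := mul_meas_ge_le_lintegral (μ := μ.restrict A) hmeas (ENNReal.ofReal (Real.exp κ))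
  have hset : A ∩ {ω | κ ≤ ∑ t ∈ Finset.Ico (half n - 1) n,
      (θ t ω * (hit x t ω - q) - θ t ω ^ 2 / 8)} ⊆
      {ω | ENNReal.ofReal (Real.exp κ) ≤ ENNReal.ofReal (Real.exp
        (∑ t ∈ Finset.Ico (half n - 1) n, (θ t ω * (hit x t ω - q) - θ t ω ^ 2 / 8)))} ∩ A :=
    fun ω h => ⟨ENNReal.ofReal_le_ofReal (Real.exp_le_exp.2 h.2), h.1⟩
  have h5 := (measure_mono (μ := μ) hset).trans (Measure.le_restrict_apply _ _)
  calc _ ≤ ENNReal.ofReal (Real.exp (-κ)) * (ENNReal.ofReal (Real.exp κ) * μ.restrict A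
      {ω | ENNReal.ofReal (Real.exp κ) ≤ ENNReal.ofReal (Real.exp
        (∑ t ∈ Finset.Ico (half n - 1) n, (θ t ω * (hit x t ω - q) - θ t ω ^ 2 / 8)))}) := by
        rw [← mul_assoc, ← ENNReal.ofReal_mul (Real.exp_pos _).le, ← Real.exp_add]
        simpa using h5
    _ ≤ _ := by gcongr; exact hmark.trans hmain

/-- One-sided deviation bound for a fixed string; the sign `s` selects the side. -/
lemma measure_signed_deviation_le [Countable 𝒳] [MeasurableSingletonClass 𝒳]
    {μ : Measure (Path 𝒳)} [IsFiniteMeasure μ]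
    (hμ : MeasurePreserving (shift : Path 𝒳 → Path 𝒳) μ μ) {σ : ℕ → 𝒳}
    {k : ℕ} (hσ : IsMemoryBound μ σ k) (x : 𝒳) (i : ℕ) {n : ℕ} (hn : 0 < n)
    {A : Set (Path 𝒳)} (hAm : MeasurableSet A)
    (hA : DependsOn (fun ω => ω ∈ A) (Set.Icc (0 : ℤ) (half n - 1 : ℕ)))
    {ε c τ s : ℝ} (hε : 0 < ε) (hc : 0 ≤ c) (hτ : τ = ε ^ 2 * c) (hτh : 1 / 2 ≤ τ)
    (hs : s ^ 2 = 1) :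
    μ (A ∩ {ω | c < visits n (k + i) σ ω ∧
      ε * visits n (k + i) σ ω * visits n k σ ω <
        s * (hits n (k + i) x σ ω * visits n k σ ω - visits n (k + i) σ ω * hits n k x σ ω)}) ≤
      ENNReal.ofReal (8 * Real.exp (-(2 * τ))) * μ A := by
  set q := pcond μ k x σ with hq
  set w : ℕ → ℝ := fun j => -(2 * ε / τ * (3 / 2) ^ j) with hw
  set F : ℝ → ℝ → ℝ → Set (Path 𝒳) := fun a b κ => A ∩ {ω | κ ≤
      a * (hits n (k + i) x σ ω - q * visits n (k + i) σ ω) +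
      b * ((hits n k x σ ω - hits n (k + i) x σ ω) -
        q * (visits n k σ ω - visits n (k + i) σ ω)) -
      a ^ 2 * visits n (k + i) σ ω / 8 -
      b ^ 2 * (visits n k σ ω - visits n (k + i) σ ω) / 8} with hF
  have hFle : ∀ a b κ, μ (F a b κ) ≤ ENNReal.ofReal (Real.exp (-κ)) * μ A := fun a b κ =>
    measure_exponent_le hμ hσ x i hn hAm hA a b κ
  have hsub : (A ∩ {ω | c < visits n (k + i) σ ω ∧
      ε * visits n (k + i) σ ω * visits n k σ ω <
        s * (hits n (k + i) x σ ω * visits n k σ ω - visits n (k + i) σ ω * hits n k x σ ω)}) ⊆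
      F (s * (4 * ε)) 0 (2 * τ - 1) ∪
        ⋃ j : ℕ, F (s * (4 * ε)) (s * w j) (2 * τ + (1 / 2 + (j : ℝ) / 4)) := by
    rintro ω ⟨hωA, h1, h2⟩
    have hML := visits_add_le n k i σ ω
    rcases exists_exponent_le (ε := ε) (c := c) (τ := τ)
      (B := s * (hits n (k + i) x σ ω - q * visits n (k + i) σ ω))
      (C := s * ((hits n k x σ ω - hits n (k + i) x σ ω) -
        q * (visits n k σ ω - visits n (k + i) σ ω)))
      (M := visits n (k + i) σ ω) (L := visits n k σ ω - visits n (k + i) σ ω)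
      hε hτ hτh (hc.trans_lt h1) h1.le (sub_nonneg.2 hML) (by
        convert h2 using 1 <;> ring) with h | ⟨j, h⟩
    · refine Or.inl ⟨hωA, h.trans (le_of_eq ?_)⟩
      rw [mul_pow s, hs]; ring
    · refine Or.inr (mem_iUnion.2 ⟨j, hωA, h.trans (le_of_eq ?_)⟩)
      rw [mul_pow s, mul_pow s, hs]; ring
  have hexp : Real.exp (-(2 * τ - 1)) ≤ 4 * Real.exp (-(2 * τ)) := by
    rw [show -(2 * τ - 1) = 1 + -(2 * τ) by ring, Real.exp_add]
    have := Real.exp_one_lt_d9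
    gcongr
    linarith
  calc _ ≤ _ := measure_mono hsub
    _ ≤ μ (F (s * (4 * ε)) 0 (2 * τ - 1)) + ∑' j : ℕ,
        μ (F (s * (4 * ε)) (s * w j) (2 * τ + (1 / 2 + (j : ℝ) / 4))) :=
      (measure_union_le _ _).trans (by gcongr; exact measure_iUnion_le _)
    _ ≤ ENNReal.ofReal (4 * Real.exp (-(2 * τ))) * μ A + ∑' j : ℕ,
        ENNReal.ofReal (Real.exp (-(2 * τ + (1 / 2 + (j : ℝ) / 4)))) * μ A := by
      gcongr with j
      · exact (hFle _ _ _).trans (by gcongr)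
      · exact hFle _ _ _
    _ ≤ ENNReal.ofReal (4 * Real.exp (-(2 * τ))) * μ A +
        ENNReal.ofReal (4 * Real.exp (-(2 * τ))) * μ A := by
      rw [ENNReal.tsum_mul_right]
      gcongr
      exact tsum_exp_le τ
    _ = _ := by
      rw [← add_mul, ← ENNReal.ofReal_add (by positivity) (by positivity)]
      ring_nf

/-- The event that the string `(σ, x)` of length `k + i + 1` is frequent and the two empirical
conditional frequencies of `x` differ by more than `ε`. -/
def deviation {𝒳 : Type*} (n k i : ℕ) (ε c : ℝ) (x : 𝒳) (σ : ℕ → 𝒳) : Set (Path 𝒳) :=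
  {ω | c < (cnt ω (k + i + 1) (withLast x σ) ((half n : ℤ) + (k + i : ℕ)) n : ℝ) ∧
    ε < |empCond ω n k x σ - empCond ω n (k + i) x σ|}

lemma measure_deviation_le [Countable 𝒳] [MeasurableSingletonClass 𝒳]
    {μ : Measure (Path 𝒳)} [IsFiniteMeasure μ]
    (hμ : MeasurePreserving (shift : Path 𝒳 → Path 𝒳) μ μ) {σ : ℕ → 𝒳}
    {k : ℕ} (hσ : IsMemoryBound μ σ k) (x : 𝒳) (i : ℕ) {n : ℕ} (hn : 0 < n)
    {A : Set (Path 𝒳)} (hAm : MeasurableSet A)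
    (hA : DependsOn (fun ω => ω ∈ A) (Set.Icc (0 : ℤ) (half n - 1 : ℕ)))
    {ε c τ : ℝ} (hε : 0 < ε) (hc : 0 ≤ c) (hτ : τ = ε ^ 2 * c) (hτh : 1 / 2 ≤ τ) :
    μ (A ∩ deviation n k i ε c x σ) ≤ ENNReal.ofReal (16 * Real.exp (-(2 * τ))) * μ A := by
  set G : ℝ → Set (Path 𝒳) := fun s => A ∩ {ω | c < visits n (k + i) σ ω ∧
      ε * visits n (k + i) σ ω * visits n k σ ω <
        s * (hits n (k + i) x σ ω * visits n k σ ω - visits n (k + i) σ ω * hits n k x σ ω)}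
    with hG
  have hGle : ∀ s : ℝ, s ^ 2 = 1 → μ (G s) ≤ ENNReal.ofReal (8 * Real.exp (-(2 * τ))) * μ A :=
    fun s hs => measure_signed_deviation_le hμ hσ x i hn hAm hA hε hc hτ hτh hs
  have hsub : A ∩ deviation n k i ε c x σ ⊆ G 1 ∪ G (-1) := by
    rintro ω ⟨hωA, h1, h2⟩
    have hemp : ∀ m, empCond ω n m x σ = hits n m x σ ω / visits n m σ ω := fun m => by
      rw [empCond, cnt_eq_sum_visit hn, cnt_withLast_eq_sum hn, hits, visits]
    have h1' : c < hits n (k + i) x σ ω := by rwa [cnt_withLast_eq_sum hn] at h1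
    have hcM := h1'.trans_le (hits_le_visits n (k + i) x σ ω)
    have hM := hc.trans_lt hcM
    have hN := hM.trans_le (visits_add_le n k i σ ω)
    rw [hemp, hemp, div_sub_div _ _ hN.ne' hM.ne', abs_div, abs_of_pos (mul_pos hN hM),
      lt_div_iff₀ (mul_pos hN hM)] at h2
    rcases lt_abs.1 h2 with h | h
    · exact Or.inr ⟨hωA, hcM, by linarith⟩
    · exact Or.inl ⟨hωA, hcM, by linarith⟩
  calc _ ≤ μ (G 1) + μ (G (-1)) := (measure_mono hsub).trans (measure_union_le _ _)
    _ ≤ ENNReal.ofReal (8 * Real.exp (-(2 * τ))) * μ A +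
        ENNReal.ofReal (8 * Real.exp (-(2 * τ))) * μ A :=
      add_le_add (hGle 1 (by norm_num)) (hGle (-1) (by norm_num))
    _ = _ := by
      rw [← add_mul, ← ENNReal.ofReal_add (by positivity) (by positivity)]
      ring_nf

lemma cnt_congr {𝒳 : Type*} {m : ℕ} {s s' : ℕ → 𝒳} (h : ∀ j < m, s j = s' j) (ω : Path 𝒳)
    (a b : ℤ) : cnt ω m s a b = cnt ω m s' a b := by
  classical
  unfold cnt
  exact congrArg Finset.card (Finset.filter_congr fun _ _ => OccursAt.congr h)

lemma withLast_congr {𝒳 : Type*} {m : ℕ} {s s' : ℕ → 𝒳} (h : ∀ j < m, s j = s' j) (x : 𝒳) :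
    ∀ j < m + 1, withLast x s j = withLast x s' j := by
  intro j hj
  unfold withLast
  split_ifs with h0
  · rfl
  · exact h _ (by omega)

lemma empCond_congr {𝒳 : Type*} {m : ℕ} {s s' : ℕ → 𝒳} (h : ∀ j < m, s j = s' j) (ω : Path 𝒳)
    (n : ℕ) (x : 𝒳) : empCond ω n m x s = empCond ω n m x s' := by
  rw [empCond, empCond, cnt_congr h, cnt_congr (withLast_congr h x)]

lemma IsMemoryBound.congr {μ : Measure (Path 𝒳)} {b b' : ℕ → 𝒳} {K : ℕ}
    (hb : IsMemoryBound μ b K) (h : ∀ j < K, b j = b' j) : IsMemoryBound μ b' K := by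
  have e : ∀ z, prependOld b K z = prependOld b' K z := fun z => funext fun j => by
    unfold prependOld
    split_ifs with hj
    · exact h j hj
    · rfl
  intro i hi y z
  rw [← e z, ← pcond_congr μ y h]
  exact hb i hi y z

lemma deviation_congr {𝒳 : Type*} {n k i : ℕ} {ε c : ℝ} {x : 𝒳} {s s' : ℕ → 𝒳}
    (h : ∀ j < k + i, s j = s' j) : deviation n k i ε c x s = deviation n k i ε c x s' := by
  ext ω
  simp only [deviation, mem_ofPred_eq]
  rw [cnt_congr (withLast_congr h x), empCond_congr h,
    empCond_congr fun j hj => h j (hj.trans_le (Nat.le_add_right k i))]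

/-- The string ending at time `t - 1`, read right-to-left. -/
def pastBefore {𝒳 : Type*} (t : ℕ) (ω : Path 𝒳) : ℕ → 𝒳 := fun j => ω ((t : ℤ) - 1 - j)

/-- Deviation for the random string of length `k + i + 1` ending at time `t`. -/
lemma measure_deviation_at_le [Countable 𝒳] [MeasurableSingletonClass 𝒳]
    {μ : Measure (Path 𝒳)} [IsProbabilityMeasure μ]
    (hμ : MeasurePreserving (shift : Path 𝒳 → Path 𝒳) μ μ)
    (k i : ℕ) {n : ℕ} (hn : 0 < n) {t : ℕ} (ht : t < half n) (hkt : k + i ≤ t)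
    {ε c τ : ℝ} (hε : 0 < ε) (hc : 0 ≤ c) (hτ : τ = ε ^ 2 * c) (hτh : 1 / 2 ≤ τ) :
    μ {ω | IsMemoryBound μ (pastBefore t ω) k ∧
      ω ∈ deviation n k i ε c (ω t) (pastBefore t ω)} ≤
      ENNReal.ofReal (16 * Real.exp (-(2 * τ))) := by
  set E : Set (Path 𝒳) := {ω | IsMemoryBound μ (pastBefore t ω) k ∧
      ω ∈ deviation n k i ε c (ω t) (pastBefore t ω)} with hE
  set P : (Fin (k + i + 1) → 𝒳) → Set (Path 𝒳) :=
    fun d => block (t : ℤ) (k + i + 1) ⁻¹' {d} with hP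
  have hcover : E ⊆ ⋃ d, E ∩ P d := fun ω hω =>
    mem_iUnion.2 ⟨block (t : ℤ) (k + i + 1) ω, hω, rfl⟩
  have hpiece : ∀ d, μ (E ∩ P d) ≤ ENNReal.ofReal (16 * Real.exp (-(2 * τ))) * μ (P d) := by
    intro d
    rcases (E ∩ P d).eq_empty_or_nonempty with he | ⟨ω₀, ⟨hmem, -⟩, hω₀⟩
    · rw [he]; simp
    · have hcoord : ∀ ω ∈ P d, ∀ j < k + i + 1, ω ((t : ℤ) - (j : ℕ)) = ω₀ ((t : ℤ) - (j : ℕ)) :=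
        fun ω hω j hj => congrFun ((show block _ _ ω = d from hω).trans
          (show block _ _ ω₀ = d from hω₀).symm) ⟨j, hj⟩
      have hsub : E ∩ P d ⊆ P d ∩ deviation n k i ε c (ω₀ t) (pastBefore t ω₀) := by
        rintro ω ⟨⟨-, hdev⟩, hω⟩
        refine ⟨hω, ?_⟩
        have h0 : ω t = ω₀ t := by simpa using hcoord ω hω 0 (by omega)
        rw [← h0, ← deviation_congr (s := pastBefore t ω)]
        · exact hdev
        · intro j hj
          have := hcoord ω hω (j + 1) (by omega)
          unfold pastBefore
          rw [show (t : ℤ) - 1 - j = t - (j + 1 : ℕ) by push_cast; ring, this]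
      refine (measure_mono hsub).trans
        (measure_deviation_le hμ hmem (ω₀ t) i hn
          (measurable_block _ _ (measurableSet_singleton d)) ?_ hε hc hτ hτh)
      intro ω ω' h
      have : block (t : ℤ) (k + i + 1) ω = block (t : ℤ) (k + i + 1) ω' := funext fun j =>
        h _ ⟨by have := j.2; omega, by omega⟩
      simp only [mem_preimage, this]
  calc μ E ≤ ∑' d, μ (E ∩ P d) := (measure_mono hcover).trans (measure_iUnion_le _)
    _ ≤ ∑' d, ENNReal.ofReal (16 * Real.exp (-(2 * τ))) * μ (P d) :=
      ENNReal.tsum_le_tsum hpiece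
    _ = _ := by
      have := tsum_measure_inter_block μ (t : ℤ) (k + i + 1) MeasurableSet.univ
      simp only [univ_inter, measure_univ] at this
      rw [ENNReal.tsum_mul_left, this, mul_one]

lemma isMemoryBound_of_memLen_eq {μ : Measure (Path 𝒳)} {b : ℕ → 𝒳} {k : ℕ}
    (h : memLen μ b = k) : IsMemoryBound μ b k := by
  have hne : {m : ℕ∞ | ∃ K : ℕ, m = (K : ℕ∞) ∧ IsMemoryBound μ b K}.Nonempty := by
    rw [nonempty_iff_ne_empty]
    intro he
    rw [memLen, he, sInf_empty] at h
    exact ENat.top_ne_natCast k h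
  obtain ⟨K, hK, hb⟩ := csInf_mem hne
  rw [memLen] at h
  rwa [← Nat.cast_injective (R := ℕ∞) (hK.symm.trans h)]

lemma exists_deviation_of_lt_hatDelta {𝒳 : Type*} {γ : ℝ} {l : ℕ → ℕ} {ω : Path 𝒳} {n k : ℕ}
    {ε : ℝ} (hε : 0 < ε) (h : ε < hatDelta γ l ω n k) :
    ∃ t < half n, ∃ i, 1 ≤ i ∧ k + i ≤ t ∧
      (∀ j < k, tildePast l ω j = pastBefore t ω j) ∧
      ω ∈ deviation n k i ε ((n : ℝ) ^ (1 - γ)) (ω t) (pastBefore t ω) := by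
  unfold hatDelta at h
  split_ifs at h with hz
  swap
  · linarith
  rw [one_mul] at h
  have hne : {d : ℝ | ∃ i : ℕ, 1 ≤ i ∧ i ≤ n ∧ ∃ z : ℕ → 𝒳, ∃ x : 𝒳,
      inL γ ω n (k + i) (withLast x (prependOld (tildePast l ω) k z)) ∧
      d = |empCond ω n k x (tildePast l ω) -
            empCond ω n (k + i) x (prependOld (tildePast l ω) k z)|}.Nonempty := by
    rw [nonempty_iff_ne_empty]
    intro he
    rw [he, Real.sSup_empty] at h
    linarith
  obtain ⟨d, ⟨i, hi, -, z, x, ⟨⟨t, ht1, ht2, hocc⟩, hfreq⟩, rfl⟩, hd⟩ := exists_lt_of_lt_csSup hne h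
  obtain ⟨t, rfl⟩ := Int.eq_ofNat_of_zero_le (a := t) (by omega)
  have hocc' := hocc
  rw [show ((t : ℕ) : ℤ) = (t : ℤ) - 1 + 1 by ring, occursAt_withLast] at hocc'
  obtain ⟨hx, hs⟩ := hocc'
  rw [sub_add_cancel] at hx
  have hs' : ∀ j < k + i, prependOld (tildePast l ω) k z j = pastBefore t ω j :=
    fun j hj => (hs j hj).symm
  have hk : ∀ j < k, tildePast l ω j = pastBefore t ω j := fun j hj => by
    rw [← hs' j (by omega), prependOld, if_pos hj]
  refine ⟨t, by omega, i, hi, by omega, hk, ?_⟩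
  rw [← deviation_congr hs', hx]
  refine ⟨hfreq, ?_⟩
  rwa [empCond_congr (s' := tildePast l ω) fun j hj => by rw [prependOld, if_pos hj]]

/-- Hoeffding bound from Step 2. For every `k < n`,
`P(Δ̂_k^n > n^{-β}, K(X̃⁰_{-∞}) = k) ≤ 2 n (n+2) e^{-2 n^{1-2β-γ}}`. -/
theorem statement8
    {𝒳 : Type*} [Countable 𝒳] [MeasurableSpace 𝒳] [MeasurableSingletonClass 𝒳]
    (μ : Measure (Path 𝒳)) [IsProbabilityMeasure μ]
    (hErg : Ergodic (shift : Path 𝒳 → Path 𝒳) μ)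
    (l : ℕ → ℕ) (hl1 : l 1 = 1) (hlmono : Monotone l)
    (hlle : ∀ k, 1 ≤ k → l k ≤ k) (hltop : Tendsto l atTop atTop)
    (β γ : ℝ) (hγ0 : 0 < γ) (hγ1 : γ < 1) (hβ0 : 0 < β) (hβγ : 2 * β + γ < 1)
    (k n : ℕ) (hkn : k < n) :
    μ {ω | (n : ℝ) ^ (-β) < hatDelta γ l ω n k ∧
        memLen μ (tildePast l ω) = (k : ℕ∞)} ≤
      ENNReal.ofReal
        (2 * (n : ℝ) * ((n : ℝ) + 2) * Real.exp (-2 * (n : ℝ) ^ (1 - 2 * β - γ))) := by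
  have hμ : MeasurePreserving (shift : Path 𝒳 → Path 𝒳) μ μ := hErg.toMeasurePreserving
  have hn : 0 < n := by omega
  have hnR : (0 : ℝ) < n := by exact_mod_cast hn
  have hn1 : (1 : ℝ) ≤ n := by exact_mod_cast hn
  set ε : ℝ := (n : ℝ) ^ (-β) with hεdef
  set c : ℝ := (n : ℝ) ^ (1 - γ) with hcdef
  set τ : ℝ := (n : ℝ) ^ (1 - 2 * β - γ) with hτdef
  have hε : 0 < ε := Real.rpow_pos_of_pos hnR _
  have hc : 0 ≤ c := (Real.rpow_pos_of_pos hnR _).le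
  have hτ : τ = ε ^ 2 * c := by
    rw [pow_two, hεdef, hcdef, ← Real.rpow_add hnR, ← Real.rpow_add hnR, hτdef]
    ring_nf
  have hτh : 1 / 2 ≤ τ := by
    have := Real.one_le_rpow hn1 (show 0 ≤ 1 - 2 * β - γ by linarith)
    linarith
  set p := ENNReal.ofReal (16 * Real.exp (-(2 * τ))) with hp
  set E : ℕ → ℕ → Set (Path 𝒳) := fun t i => {ω | IsMemoryBound μ (pastBefore t ω) k ∧
      ω ∈ deviation n k i ε c (ω t) (pastBefore t ω)} with hE
  have hsub : {ω | ε < hatDelta γ l ω n k ∧ memLen μ (tildePast l ω) = (k : ℕ∞)} ⊆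
      ⋃ t ∈ Finset.range (half n), ⋃ i ∈ Finset.Icc 1 (t - k), E t i := by
    rintro ω ⟨h1, h2⟩
    obtain ⟨t, ht, i, hi, hkt, hk, hdev⟩ := exists_deviation_of_lt_hatDelta hε h1
    simp only [mem_iUnion, exists_prop]
    exact ⟨t, Finset.mem_range.2 ht, i, Finset.mem_Icc.2 ⟨hi, by omega⟩,
      (isMemoryBound_of_memLen_eq h2).congr hk, hdev⟩
  have hinner : ∀ t ∈ Finset.range (half n),
      μ (⋃ i ∈ Finset.Icc 1 (t - k), E t i) ≤ (t : ℝ≥0∞) * p := by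
    intro t ht
    calc _ ≤ ∑ i ∈ Finset.Icc 1 (t - k), μ (E t i) := measure_biUnion_finset_le _ _
      _ ≤ ∑ i ∈ Finset.Icc 1 (t - k), p := Finset.sum_le_sum fun i hi => by
        have := Finset.mem_Icc.1 hi
        exact measure_deviation_at_le hμ k i hn (Finset.mem_range.1 ht) (by omega) hε hc hτ hτh
      _ ≤ _ := by
        rw [Finset.sum_const, nsmul_eq_mul, Nat.card_Icc]
        gcongr
        omega
  have hcount : ((∑ t ∈ Finset.range (half n), t : ℕ) : ℝ) * 16 ≤ 2 * n * (n + 2) := by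
    have h1 := Finset.sum_range_id_mul_two (half n)
    have h2 : half n * (half n - 1) * 8 ≤ 2 * n * (n + 2) := by
      obtain ⟨a, ha⟩ : ∃ a, half n = a + 1 := ⟨half n - 1, by unfold half; omega⟩
      have h3 : 2 * a + 1 ≤ n := by unfold half at ha; omega
      rw [ha, Nat.add_sub_cancel]
      nlinarith
    exact_mod_cast (by omega : (∑ t ∈ Finset.range (half n), t) * 16 ≤ 2 * n * (n + 2))
  calc _ ≤ _ := measure_mono hsub
    _ ≤ ∑ t ∈ Finset.range (half n), μ (⋃ i ∈ Finset.Icc 1 (t - k), E t i) :=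
      measure_biUnion_finset_le _ _
    _ ≤ ∑ t ∈ Finset.range (half n), (t : ℝ≥0∞) * p := Finset.sum_le_sum hinner
    _ = ENNReal.ofReal (((∑ t ∈ Finset.range (half n), t : ℕ) : ℝ) *
        (16 * Real.exp (-(2 * τ)))) := by
      rw [← Finset.sum_mul, ENNReal.ofReal_mul (by positivity), ENNReal.ofReal_natCast,
        Nat.cast_sum]
    _ ≤ _ := by
      rw [neg_mul, ← mul_assoc]
      gcongr

end MWPrediction
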